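/- Let d ≥ 1 and let F_0,…,F_{L−1} be contracting similitudes of ℝ^d all with the same contraction ratio β ∈ (0,1) (i.e., ‖F_j(x) − F_j(y)‖ = β‖x − y‖ for all x, y). Let Ω ⊂ ℝ^d be a d-dimensional convex polytope (the convex hull of a finite set, with nonempty interior), and assume F_j(Ω) ⊆ Ω for every j and Ω = ⋃_{j=0}^{L−1} F_j(Ω). For n ≥ 1 put W_n = ⋃ F_{j_1}∘…∘F_{j_n}(Ω), the union over all words (j_1,…,j_n) ∈ {0,…,L−1}^n in which at least one letter equals 0, and W = ⋃_{n≥1} W_n. Then: (1) W_n ⊆ W_{n+1} for all n ≥ 1; (2) the Hausdorff dimension of Ω \ W is strictly less than d; in particular L_d(Ω \ W) = 0. -/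

import Mathlib

open MeasureTheory

/-- Composition `F_{w 0} ∘ F_{w 1} ∘ … ∘ F_{w (n-1)}` of members of an IFS
along a word `w` of length `n`. -/
def compIFS {E : Type*} {L : ℕ} (F : Fin L → E → E) : (n : ℕ) → (Fin n → Fin L) → E → E
  | 0, _ => id
  | n + 1, w => F (w 0) ∘ compIFS F n fun k => w k.succ

open Set Filter Topology

section Porous

variable {ι : Type*}

/-- A set is uniformly porous with constant `c` when, at every point and every scale `r ≤ 1`, a
ball of radius `c * r` centred within distance `r` misses the set. -/
def UniformlyPorous {X : Type*} [PseudoMetricSpace X] (c : ℝ) (E : Set X) : Prop :=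
  ∀ x ∈ E, ∀ r : ℝ, 0 < r → r ≤ 1 → ∃ y, dist y x ≤ r ∧ Disjoint (Metric.ball y (c * r)) E

/-- The index of the cube of the `N`-adic grid of side `N ^ (-k)` that contains `x`. -/
noncomputable def gridIndex (N k : ℕ) (x : EuclideanSpace ℝ ι) : ι → ℤ :=
  fun i => ⌊(N : ℝ) ^ k * x i⌋

lemma gridIndex_succ_ediv {N : ℕ} (hN : 0 < N) (k : ℕ) (x : EuclideanSpace ℝ ι) (i : ι) :
    gridIndex N (k + 1) x i / N = gridIndex N k x i := by
  have hN' : (N : ℝ) ≠ 0 := by positivity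
  rw [gridIndex, gridIndex, ← Int.floor_div_natCast]
  congr 1
  field_simp
  ring

variable [Fintype ι]

lemma EuclideanSpace.dist_le_sqrt_card_mul {x y : EuclideanSpace ℝ ι} {K : ℝ} (hK : 0 ≤ K)
    (h : ∀ i, |x i - y i| ≤ K) : dist x y ≤ √(Fintype.card ι) * K := by
  rw [EuclideanSpace.dist_eq]
  refine Real.sqrt_le_iff.2 ⟨by positivity, ?_⟩
  rw [mul_pow, Real.sq_sqrt (by positivity)]
  calc ∑ i, dist (x i) (y i) ^ 2 ≤ ∑ _i : ι, K ^ 2 := by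
        refine Finset.sum_le_sum fun i _ => ?_
        rw [Real.dist_eq]
        exact pow_le_pow_left₀ (abs_nonneg _) (h i) 2
    _ = Fintype.card ι * K ^ 2 := by simp

lemma EuclideanSpace.abs_sub_apply_le_dist (x y : EuclideanSpace ℝ ι) (i : ι) :
    |x i - y i| ≤ dist x y := by
  rw [dist_eq_norm]
  simpa using PiLp.norm_apply_le (x - y) i

lemma dist_le_of_gridIndex_eq {N k : ℕ} (hN : 0 < N) {x y : EuclideanSpace ℝ ι}
    (h : gridIndex N k x = gridIndex N k y) :
    dist x y ≤ √(Fintype.card ι) * ((N : ℝ) ^ k)⁻¹ := by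
  have hpos : (0 : ℝ) < (N : ℝ) ^ k := by positivity
  refine EuclideanSpace.dist_le_sqrt_card_mul (by positivity) fun i => ?_
  have h1 := Int.abs_sub_lt_one_of_floor_eq_floor (congrFun h i)
  rw [← mul_sub, abs_mul, abs_of_pos hpos] at h1
  rw [← one_div, le_div_iff₀ hpos]
  linarith

lemma Bornology.IsBounded.finite_image_gridIndex {E : Set (EuclideanSpace ℝ ι)}
    (hE : Bornology.IsBounded E) (N k : ℕ) : (gridIndex N k '' E).Finite := by
  classical
  obtain ⟨R, hR⟩ := hE.subset_closedBall 0
  refine (Set.finite_Icc (fun _ : ι => ⌊-((N : ℝ) ^ k * R)⌋) (fun _ => ⌊(N : ℝ) ^ k * R⌋)).subset ?_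
  rintro _ ⟨x, hx, rfl⟩
  have key : ∀ i, |x i| ≤ R := fun i => by
    have h1 := EuclideanSpace.abs_sub_apply_le_dist x 0 i
    have h2 := Metric.mem_closedBall.1 (hR hx)
    simp only [PiLp.zero_apply, sub_zero] at h1
    linarith
  refine ⟨fun i => Int.floor_le_floor ?_, fun i => Int.floor_le_floor ?_⟩
  · rw [← mul_neg]
    exact mul_le_mul_of_nonneg_left (abs_le.1 (key i)).1 (by positivity)
  · exact mul_le_mul_of_nonneg_left (abs_le.1 (key i)).2 (by positivity)

/-- Every grid cube has a subcube of the next generation that misses a porous set. -/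
lemma UniformlyPorous.exists_notMem_image_gridIndex {c : ℝ} {E : Set (EuclideanSpace ℝ ι)}
    (hE : UniformlyPorous c E) {m : ℕ} (hm : 4 < m) (hmc : 4 * √(Fintype.card ι) < c * m)
    (k : ℕ) (z : ι → ℤ) :
    ∃ z' : ι → ℤ, (∀ i, z' i / (2 * m : ℕ) = z i) ∧ z' ∉ gridIndex (2 * m) (k + 1) '' E := by
  set N := 2 * m with hN
  have hNpos : 0 < N := by omega
  by_cases hmid : (fun i => z i * N + m) ∈ gridIndex N (k + 1) '' E
  swap
  · refine ⟨_, fun i => ?_, hmid⟩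
    rw [add_comm, Int.add_mul_ediv_right _ _ (by positivity), Int.ediv_eq_zero_of_lt] <;> omega
  obtain ⟨x, hxE, hx⟩ := hmid
  have hk : (0 : ℝ) < (N : ℝ) ^ k := by positivity
  have hk1 : (1 : ℝ) ≤ (N : ℝ) ^ k := one_le_pow₀ (by exact_mod_cast hNpos)
  have hm' : (4 : ℝ) < m := by exact_mod_cast hm
  have hNm : (N : ℝ) = 2 * m := by simp [hN]
  obtain ⟨y, hyx, hy⟩ := hE x hxE (4⁻¹ * ((N : ℝ) ^ k)⁻¹) (by positivity)
    (by have := inv_le_one_of_one_le₀ hk1; linarith)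
  refine ⟨gridIndex N (k + 1) y, fun i => ?_, ?_⟩
  · rw [gridIndex_succ_ediv hNpos, gridIndex, Int.floor_eq_iff]
    have h1 := (EuclideanSpace.abs_sub_apply_le_dist y x i).trans hyx
    have h2 : |(N : ℝ) ^ k * y i - (N : ℝ) ^ k * x i| ≤ 4⁻¹ := by
      rw [← mul_sub, abs_mul, abs_of_pos hk]
      calc _ ≤ (N : ℝ) ^ k * (4⁻¹ * ((N : ℝ) ^ k)⁻¹) := by gcongr
        _ = 4⁻¹ := by field_simp
    have h3 := congrFun hx i
    rw [gridIndex, Int.floor_eq_iff] at h3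
    push_cast at h3
    rw [pow_succ] at h3
    obtain ⟨h4, h5⟩ := abs_le.1 h2
    obtain ⟨h6, h7⟩ := h3
    constructor
    · by_contra! hlt
      nlinarith
    · by_contra! hlt
      nlinarith
  · rintro ⟨u, huE, hu⟩
    refine Set.disjoint_left.1 hy ?_ huE
    refine Metric.mem_ball.2 ((dist_le_of_gridIndex_eq hNpos hu).trans_lt ?_)
    rw [pow_succ, mul_inv, ← mul_assoc, ← mul_assoc, mul_right_comm]
    refine mul_lt_mul_of_pos_right ?_ (inv_pos.2 hk)
    rw [← div_eq_mul_inv, ← div_eq_mul_inv, div_lt_div_iff₀ (by positivity) (by positivity), hNm]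
    have : 0 ≤ √(Fintype.card ι : ℝ) := Real.sqrt_nonneg _
    nlinarith

lemma UniformlyPorous.ncard_image_gridIndex_succ_le {c : ℝ} {E : Set (EuclideanSpace ℝ ι)}
    (hE : UniformlyPorous c E) (hb : Bornology.IsBounded E) {m : ℕ} (hm : 4 < m)
    (hmc : 4 * √(Fintype.card ι) < c * m) (k : ℕ) :
    (gridIndex (2 * m) (k + 1) '' E).ncard ≤
      ((2 * m) ^ Fintype.card ι - 1) * (gridIndex (2 * m) k '' E).ncard := by
  classical
  have hNpos : 0 < 2 * m := by omega
  have hf := fun k => hb.finite_image_gridIndex (2 * m) k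
  rw [Set.ncard_eq_toFinset_card _ (hf _), Set.ncard_eq_toFinset_card _ (hf _)]
  refine Finset.card_le_mul_card_image_of_maps_to
    (f := fun (z : ι → ℤ) i => z i / (2 * m : ℕ)) ?_ _ ?_
  · intro z hz
    simp only [Set.Finite.mem_toFinset] at hz ⊢
    obtain ⟨x, hx, rfl⟩ := hz
    exact ⟨x, hx, funext fun i => (gridIndex_succ_ediv hNpos k x i).symm⟩
  · intro z _
    obtain ⟨z', hz', hz'E⟩ := hE.exists_notMem_image_gridIndex hm hmc k z
    set T : Finset (ι → ℤ) := Fintype.piFinset fun i =>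
      Finset.Ico (z i * (2 * m : ℕ)) (z i * (2 * m : ℕ) + (2 * m : ℕ)) with hT
    have hmem : ∀ w : ι → ℤ, (∀ i, w i / (2 * m : ℕ) = z i) → w ∈ T := by
      intro w hw
      rw [hT, Fintype.mem_piFinset]
      intro i
      have hp : (0 : ℤ) < (2 * m : ℕ) := by exact_mod_cast hNpos
      have := (Int.ediv_eq_iff_of_pos hp).1 (hw i)
      rw [Finset.mem_Ico]
      constructor <;> linarith [this.1, this.2]
    have hTcard : T.card = (2 * m) ^ Fintype.card ι := by
      have : (2 * (m : ℤ)).toNat = 2 * m := by omega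
      simp [hT, Fintype.card_piFinset, this]
    rw [← hTcard, ← Finset.card_erase_of_mem (hmem z' hz')]
    refine Finset.card_le_card fun w hw => ?_
    rw [Finset.mem_filter, Set.Finite.mem_toFinset] at hw
    refine Finset.mem_erase.2 ⟨?_, hmem w fun i => congrFun hw.2 i⟩
    rintro rfl
    exact hz'E hw.1

/-- A bounded uniformly porous subset of Euclidean space has Hausdorff dimension smaller than that
of the space. -/
theorem UniformlyPorous.dimH_lt [Nonempty ι] {c : ℝ} (hc : 0 < c)
    {E : Set (EuclideanSpace ℝ ι)} (hE : UniformlyPorous c E) (hb : Bornology.IsBounded E) :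
    dimH E < Fintype.card ι := by
  obtain ⟨m₀, hm₀⟩ := exists_nat_gt (4 * √(Fintype.card ι : ℝ) / c)
  set m := max m₀ 5 with hmdef
  have hm : 4 < m := by omega
  have hmc : 4 * √(Fintype.card ι : ℝ) < c * m := by
    rw [div_lt_iff₀' hc] at hm₀
    have : (m₀ : ℝ) ≤ m := by exact_mod_cast le_max_left _ _
    nlinarith
  set N := 2 * m with hN
  set D := Fintype.card ι with hD
  have hDpos : 0 < D := Fintype.card_pos
  have hNpos : 0 < N := by omega
  have hN1 : (1 : ℝ) < N := by exact_mod_cast (by omega : 1 < N)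
  set M := N ^ D - 1 with hM
  have hM1 : 1 ≤ M := by
    have := Nat.le_self_pow hDpos.ne' N
    omega
  have hMN : (M : ℝ) < (N : ℝ) ^ (D : ℝ) := by
    rw [Real.rpow_natCast]
    exact_mod_cast (by have := Nat.pow_pos (n := D) hNpos; omega : M < N ^ D)
  have hMpos : (0 : ℝ) < M := by exact_mod_cast hM1
  set t := Real.logb N M with ht
  have ht0 : 0 ≤ t := Real.logb_nonneg hN1 (by exact_mod_cast hM1)
  have htD : t < D := (Real.logb_lt_iff_lt_rpow hN1 hMpos).2 hMN
  have hNt : (N : ℝ) ^ t = M := Real.rpow_logb (by linarith) hN1.ne' hMpos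
  have hcard : ∀ k, (gridIndex N k '' E).ncard ≤ M ^ k * (gridIndex N 0 '' E).ncard := by
    intro k
    induction k with
    | zero => simp
    | succ k ih =>
      refine (hE.ncard_image_gridIndex_succ_le hb hm hmc k).trans ?_
      rw [pow_succ', mul_assoc]
      exact Nat.mul_le_mul_left _ ih
  have hf := fun k => hb.finite_image_gridIndex N k
  let : ∀ k, Fintype (gridIndex N k '' E) := fun k => (hf k).fintype
  set r : ℕ → ℝ := fun k => √(D : ℝ) * ((N : ℝ) ^ k)⁻¹ with hr
  have hr0 : Tendsto (fun k => ENNReal.ofReal (r k)) atTop (𝓝 0) := by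
    rw [← ENNReal.ofReal_zero]
    refine ENNReal.tendsto_ofReal ?_
    rw [← mul_zero (√(D : ℝ))]
    exact (tendsto_inv_atTop_zero.comp (tendsto_pow_atTop_atTop_of_one_lt hN1)).const_mul _
  have hdiam : ∀ k (z : gridIndex N k '' E),
      Metric.ediam (gridIndex N k ⁻¹' {(z : ι → ℤ)}) ≤ ENNReal.ofReal (r k) := by
    intro k z
    refine Metric.ediam_le fun x hx y hy => ?_
    rw [edist_dist]
    exact ENNReal.ofReal_le_ofReal
      (dist_le_of_gridIndex_eq hNpos ((hx : _ = _).trans (hy : _ = _).symm))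
  have hmeas := Measure.hausdorffMeasure_le_liminf_sum t E (l := atTop)
    (fun k => ENNReal.ofReal (r k)) hr0
    (fun k (z : gridIndex N k '' E) => gridIndex N k ⁻¹' {(z : ι → ℤ)})
    (Eventually.of_forall hdiam)
    (Eventually.of_forall fun k x hx => mem_iUnion.2 ⟨⟨_, mem_image_of_mem _ hx⟩, rfl⟩)
  set B : ENNReal := ENNReal.ofReal ((gridIndex N 0 '' E).ncard * √(D : ℝ) ^ t) with hB
  have hsum : ∀ k, ∑ z : gridIndex N k '' E,
      Metric.ediam (gridIndex N k ⁻¹' {(z : ι → ℤ)}) ^ t ≤ B := by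
    intro k
    have hrk : 0 ≤ r k := by positivity
    calc _ ≤ ∑ z : gridIndex N k '' E, ENNReal.ofReal (r k ^ t) := by
          refine Finset.sum_le_sum fun z _ => ?_
          rw [← ENNReal.ofReal_rpow_of_nonneg hrk ht0]
          exact ENNReal.rpow_le_rpow (hdiam k z) ht0
      _ = ENNReal.ofReal ((gridIndex N k '' E).ncard * r k ^ t) := by
          rw [Finset.sum_const, nsmul_eq_mul, ENNReal.ofReal_mul (by positivity),
            ENNReal.ofReal_natCast, Finset.card_univ, Set.ncard_eq_toFinset_card',
            Set.toFinset_card]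
      _ ≤ B := by
          refine ENNReal.ofReal_le_ofReal ?_
          have h1 : r k ^ t = √(D : ℝ) ^ t * ((M : ℝ) ^ k)⁻¹ := by
            rw [hr, Real.mul_rpow (by positivity) (by positivity), Real.inv_rpow (by positivity),
              ← hNt, Real.rpow_pow_comm (by positivity)]
          have h2 : ((gridIndex N k '' E).ncard : ℝ) ≤ M ^ k * (gridIndex N 0 '' E).ncard := by
            exact_mod_cast hcard k
          rw [h1]
          calc _ ≤ (M ^ k * (gridIndex N 0 '' E).ncard) * (√(D : ℝ) ^ t * ((M : ℝ) ^ k)⁻¹) := by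
                gcongr
            _ = _ := by field_simp
  have hfin : Measure.hausdorffMeasure t E ≠ ⊤ := by
    refine ((hmeas.trans (liminf_le_of_frequently_le' (Frequently.of_forall hsum))).trans_lt
      ENNReal.ofReal_lt_top).ne
  rw [← Real.coe_toNNReal t ht0] at hfin
  refine (dimH_le_of_hausdorffMeasure_ne_top hfin).trans_lt ?_
  exact_mod_cast (Real.toNNReal_lt_natCast hDpos.ne').2 htD

end Porous

section Similitude

variable {E : Type*}

/-- A homothetic self-map of a finite-dimensional Euclidean space is onto. -/
lemma surjective_of_dist_eq_mul [NormedAddCommGroup E] [InnerProductSpace ℝ E]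
    [FiniteDimensional ℝ E] {f : E → E} {b : ℝ} (hb : 0 < b)
    (hf : ∀ x y, dist (f x) (f y) = b * dist x y) : Function.Surjective f := by
  have : Inhabited E := ⟨0⟩
  have hg : Isometry fun x => b⁻¹ • f x := by
    refine Isometry.of_dist_eq fun x y => ?_
    rw [dist_smul₀, hf, Real.norm_of_nonneg (by positivity), inv_mul_cancel_left₀ hb.ne']
  intro y
  obtain ⟨x, hx⟩ := (hg.affineIsometryOfStrictConvexSpace.toAffineIsometryEquiv rfl).surjective
    (b⁻¹ • y)
  exact ⟨x, smul_right_injective E (inv_ne_zero hb.ne') hx⟩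

lemma image_ball_of_dist_eq_mul [PseudoMetricSpace E] {f : E → E} {b : ℝ} (hb : 0 < b)
    (hf : ∀ x y, dist (f x) (f y) = b * dist x y) (hs : Function.Surjective f) (x : E) (r : ℝ) :
    f '' Metric.ball x r = Metric.ball (f x) (b * r) := by
  ext y
  obtain ⟨y, rfl⟩ := hs y
  rw [Metric.mem_ball, hf, mul_lt_mul_iff_right₀ hb]
  constructor
  · rintro ⟨z, hz, hzy⟩
    have h0 : b * dist y z = 0 := by
      rw [← hf, hzy, dist_self]
    have h1 : dist y z = 0 := by simpa [hb.ne'] using h0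
    linarith [dist_triangle y z x, Metric.mem_ball.1 hz]
  · exact fun h => ⟨y, h, rfl⟩

variable {L : ℕ} {F : Fin L → E → E}

lemma compIFS_snoc (n : ℕ) (w : Fin n → Fin L) (j : Fin L) :
    compIFS F (n + 1) (Fin.snoc w j) = compIFS F n w ∘ F j := by
  induction n with
  | zero => simp [compIFS, Fin.snoc]
  | succ n ih =>
    rw [compIFS, compIFS.eq_2 F n w, Function.comp_assoc, ← ih]
    congr 2
    funext k
    refine Fin.lastCases ?_ (fun k => ?_) k
    · simp only [Fin.succ_last, Fin.snoc_last]
    · rw [Fin.succ_castSucc, Fin.snoc_castSucc, Fin.snoc_castSucc]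

lemma dist_compIFS [PseudoMetricSpace E] {β : ℝ}
    (hF : ∀ j x y, dist (F j x) (F j y) = β * dist x y) (n : ℕ) (w : Fin n → Fin L) (x y : E) :
    dist (compIFS F n w x) (compIFS F n w y) = β ^ n * dist x y := by
  induction n with
  | zero => simp [compIFS]
  | succ n ih => simp only [compIFS, Function.comp_apply, hF, ih, pow_succ', mul_assoc]

lemma compIFS_image_subset_iUnion_snoc {Ω : Set E} (hcover : Ω = ⋃ j, F j '' Ω) (n : ℕ)
    (w : Fin n → Fin L) :
    compIFS F n w '' Ω ⊆ ⋃ j, compIFS F (n + 1) (Fin.snoc w j) '' Ω := by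
  rintro _ ⟨x, hx, rfl⟩
  rw [hcover] at hx
  obtain ⟨j, y, hy, rfl⟩ := mem_iUnion.1 hx
  exact mem_iUnion.2 ⟨j, y, hy, by rw [compIFS_snoc]; rfl⟩

lemma subset_iUnion_compIFS_image {Ω : Set E} (hcover : Ω = ⋃ j, F j '' Ω) (n : ℕ) :
    Ω ⊆ ⋃ w, compIFS F n w '' Ω := by
  induction n with
  | zero => exact fun x hx => mem_iUnion.2 ⟨Fin.elim0, x, hx, rfl⟩
  | succ n ih =>
    intro x hx
    obtain ⟨w, hw⟩ := mem_iUnion.1 (ih hx)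
    obtain ⟨j, hj⟩ := mem_iUnion.1 (compIFS_image_subset_iUnion_snoc hcover n w hw)
    exact mem_iUnion.2 ⟨_, hj⟩

/-- The points of a bounded self-similar set with interior that lie in no cylinder using a given
letter `j` form a uniformly porous set. -/
lemma uniformlyPorous_diff_compIFS [NormedAddCommGroup E] [InnerProductSpace ℝ E]
    [FiniteDimensional ℝ E] {β : ℝ} (hβ0 : 0 < β) (hβ1 : β < 1)
    (hF : ∀ j x y, dist (F j x) (F j y) = β * dist x y) {Ω : Set E}
    (hb : Bornology.IsBounded Ω) (hint : (interior Ω).Nonempty) (hsub : ∀ j, F j '' Ω ⊆ Ω)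
    (hcover : Ω = ⋃ j, F j '' Ω) (j : Fin L) {V : Set E}
    (hV : ∀ n (w : Fin n → Fin L), compIFS F (n + 1) (Fin.snoc w j) '' Ω ⊆ V) :
    ∃ c > 0, UniformlyPorous c (Ω \ V) := by
  obtain ⟨p, hp⟩ := hint
  obtain ⟨ρ, hρ, hpρ⟩ := Metric.isOpen_iff.1 isOpen_interior p hp
  have hpρ' : Metric.ball p ρ ⊆ Ω := hpρ.trans interior_subset
  have hpΩ : p ∈ Ω := interior_subset hp
  obtain ⟨R₀, hR₀⟩ := Metric.isBounded_iff.1 hb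
  set R := max R₀ 1 with hR
  have hR1 : 1 ≤ R := le_max_right _ _
  have hdist : ∀ x ∈ Ω, ∀ y ∈ Ω, dist x y ≤ R := fun x hx y hy =>
    (hR₀ hx hy).trans (le_max_left _ _)
  refine ⟨β ^ 2 * ρ / R, by positivity, fun x hx r hr0 hr1 => ?_⟩
  obtain ⟨n, hn1, hn2⟩ := exists_nat_pow_near_of_lt_one (div_pos hr0 (by positivity : 0 < R))
    (div_le_one_of_le₀ (hr1.trans hR1) (by positivity)) hβ0 hβ1
  rw [lt_div_iff₀ (by positivity)] at hn1
  obtain ⟨w, q, hq, hqx⟩ := mem_iUnion.1 (subset_iUnion_compIFS_image hcover (n + 1) hx.1)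
  refine ⟨compIFS F (n + 1) w (F j p), ?_, ?_⟩
  · rw [← hqx, dist_compIFS hF]
    have := hdist _ (hsub j ⟨p, hpΩ, rfl⟩) q hq
    calc _ ≤ β ^ (n + 1) * R := by gcongr
      _ ≤ r := hn1.le
  · refine Set.disjoint_left.2 fun u hu huE => huE.2 (hV (n + 1) w ?_)
    have hsim := dist_compIFS hF (n + 2) (Fin.snoc w j : Fin (n + 2) → Fin L)
    have hpos : 0 < β ^ (n + 2) := by positivity
    refine image_mono hpρ' ?_
    rw [image_ball_of_dist_eq_mul hpos hsim (surjective_of_dist_eq_mul hpos hsim), compIFS_snoc]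
    refine Metric.ball_subset_ball ?_ hu
    calc β ^ 2 * ρ / R * r = β ^ 2 * ρ * (r / R) := by ring
      _ ≤ β ^ 2 * ρ * β ^ n := by gcongr
      _ = β ^ (n + 2) * ρ := by ring

end Similitude

/-- Key lemma: for an IFS of similitudes with common ratio `β` on a
`d`-dimensional convex polytope `Ω` with no holes, the sets `W_n` (unions of
cylinder pieces whose word contains the letter `0`) are nested, and the
complement `Ω \ W` of their union has Hausdorff dimension `< d`; in
particular it is Lebesgue-null. -/
theorem stmt10 (d L : ℕ) (hd : 1 ≤ d) (hL : 0 < L)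
    (β : ℝ) (hβ0 : 0 < β) (hβ1 : β < 1)
    (F : Fin L → EuclideanSpace ℝ (Fin d) → EuclideanSpace ℝ (Fin d))
    (hF : ∀ j x y, dist (F j x) (F j y) = β * dist x y)
    (Ω : Set (EuclideanSpace ℝ (Fin d)))
    (s : Finset (EuclideanSpace ℝ (Fin d))) (hΩ : Ω = convexHull ℝ ↑s)
    (hint : (interior Ω).Nonempty)
    (hsub : ∀ j, F j '' Ω ⊆ Ω) (hcover : Ω = ⋃ j, F j '' Ω)
    (W : ℕ → Set (EuclideanSpace ℝ (Fin d)))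
    (hW : ∀ n, W n = ⋃ (w : Fin n → Fin L) (_ : ∃ k, w k = ⟨0, hL⟩),
      compIFS F n w '' Ω) :
    (∀ n, 1 ≤ n → W n ⊆ W (n + 1)) ∧
    dimH (Ω \ ⋃ (n : ℕ) (_ : 1 ≤ n), W n) < d ∧
    volume (Ω \ ⋃ (n : ℕ) (_ : 1 ≤ n), W n) = 0 := by
  have hbdd : Bornology.IsBounded Ω := hΩ ▸ isBounded_convexHull.2 s.finite_toSet.isBounded
  refine ⟨fun n _ => ?_, ?_⟩
  · rw [hW, hW]
    refine iUnion₂_subset fun w hw => (compIFS_image_subset_iUnion_snoc hcover n w).trans ?_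
    obtain ⟨k, hk⟩ := hw
    refine iUnion_subset fun j => ?_
    exact subset_iUnion₂_of_subset (Fin.snoc w j) ⟨k.castSucc, by simpa using hk⟩ subset_rfl
  have : Nonempty (Fin d) := ⟨⟨0, hd⟩⟩
  obtain ⟨c, hc, hporous⟩ := uniformlyPorous_diff_compIFS hβ0 hβ1 hF hbdd hint hsub hcover
    ⟨0, hL⟩ (V := ⋃ (n : ℕ) (_ : 1 ≤ n), W n) fun n w => by
      refine subset_iUnion₂_of_subset (n + 1) (Nat.le_add_left 1 n) ?_
      rw [hW]
      exact subset_iUnion₂_of_subset (Fin.snoc w ⟨0, hL⟩)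
        ⟨Fin.last n, Fin.snoc_last (α := fun _ => Fin L) _ _⟩ subset_rfl
  have hdim := hporous.dimH_lt hc (hbdd.subset sdiff_subset)
  rw [Fintype.card_fin] at hdim
  refine ⟨hdim, ?_⟩
  have hac : (volume : Measure (EuclideanSpace ℝ (Fin d))) ≪
      Measure.hausdorffMeasure (Module.finrank ℝ (EuclideanSpace ℝ (Fin d))) :=
    Measure.absolutelyContinuous_isAddHaarMeasure _ _
  rw [finrank_euclideanSpace_fin] at hac
  exact measure_zero_of_dimH_lt (d := (d : NNReal)) (by simpa using hac) (by simpa using hdim)
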